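/- arXiv:2511.15491 — 4 statements merged into one kernel-verified Lean document; each statement's English description precedes it below -/
import Mathlib

section
/- Let G be a finite connected chordal graph, let s be a vertex of G, and let k ≥ 0. If x and y are distinct vertices with d(x,s) = d(y,s) = k and there is a vertex v adjacent to both x and y with d(v,s) = k+1, then x and y are adjacent. -/
open SimpleGraph

/-- A graph is chordal if it has no induced cycle of length at least 4. -/
def Chordal {V : Type} (G : SimpleGraph V) : Prop :=
  ∀ (s : Set V) (m : ℕ), 4 ≤ m → IsEmpty ((G.induce s) ≃g cycleGraph m)

lemma SimpleGraph.cycleGraph_adj_iff_of_le {n : ℕ} {i j : Fin (n + 2)} (hij : i ≤ j) :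
    (cycleGraph (n + 2)).Adj i j ↔ i.val + 1 = j.val ∨ (i.val = 0 ∧ j.val = n + 1) := by
  rw [cycleGraph_adj']
  have hj := j.isLt
  have hle : i.val ≤ j.val := hij
  rw [Fin.sub_val_of_le hij]
  rcases hle.eq_or_lt with h | h
  · obtain rfl := Fin.ext h
    simp only [sub_self, Fin.val_zero]
    omega
  · have : (i - j).val = n + 2 - j.val + i.val := by
      rw [Fin.val_sub, Nat.mod_eq_of_lt (by omega)]
    omega

/-- An embedding of a cycle of length at least 4 contradicts chordality. -/
lemma Chordal.isEmpty_embedding {V : Type} {G : SimpleGraph V} (hG : Chordal G) {m : ℕ}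
    (hm : 4 ≤ m) : IsEmpty (cycleGraph m ↪g G) := by
  refine ⟨fun f => (hG (Set.range f) m hm).false (Iso.symm ?_)⟩
  exact ⟨Equiv.ofInjective f f.injective, by simp⟩

section Geodesic

variable {W : Type*} {H : SimpleGraph W} {a b : W} {p : H.Walk a b}

lemma SimpleGraph.Walk.dist_getVert_of_length_eq_dist (hp : p.length = H.dist a b) {i : ℕ}
    (hi : i ≤ p.length) : H.dist a (p.getVert i) = i := by
  have h₁ := dist_le (p.take i)
  have h₂ := dist_le (p.drop i)
  have h₃ := (p.take i).reachable.dist_triangle_left b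
  rw [Walk.take_length] at h₁
  rw [Walk.drop_length] at h₂
  omega

lemma SimpleGraph.Walk.getVert_inj_of_length_eq_dist (hp : p.length = H.dist a b) {i j : ℕ}
    (hi : i ≤ p.length) (hj : j ≤ p.length) (h : p.getVert i = p.getVert j) : i = j := by
  rw [← dist_getVert_of_length_eq_dist hp hi, h, dist_getVert_of_length_eq_dist hp hj]

lemma SimpleGraph.Walk.adj_getVert_iff_of_length_eq_dist (hp : p.length = H.dist a b) {i j : ℕ}
    (hij : i ≤ j) (hj : j ≤ p.length) :
    H.Adj (p.getVert i) (p.getVert j) ↔ i + 1 = j := by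
  constructor
  · intro h
    have hne : i ≠ j := by
      rintro rfl
      exact h.ne rfl
    have h₁ := (p.take i).reachable.dist_triangle_left (p.getVert j)
    rw [dist_getVert_of_length_eq_dist hp hj, dist_getVert_of_length_eq_dist hp (hij.trans hj),
      dist_eq_one_iff_adj.2 h] at h₁
    omega
  · rintro rfl
    exact p.adj_getVert_succ hj

end Geodesic

/-- Vertices of `S` reach `s` inside `G.induce S` if every vertex of `S` other than `s` has
a neighbor in `S` closer to `s`. -/
lemma SimpleGraph.induce_reachable_of_exists_closer {V : Type*} {G : SimpleGraph V} {S : Set V} (s : S)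
    (h : ∀ u ∈ S, u ≠ s → ∃ w ∈ S, G.Adj u w ∧ G.dist w s < G.dist u s) (u : S) :
    (G.induce S).Reachable u s := by
  induction hd : G.dist u s using Nat.strong_induction_on generalizing u with
  | _ d ih =>
    by_cases hus : u = s
    · rw [hus]
    · obtain ⟨w, hw, huw, hlt⟩ := h u u.2 (fun e => hus (Subtype.ext e))
      have hadj : (G.induce S).Adj u ⟨w, hw⟩ := huw
      exact hadj.reachable.trans (ih _ (hd ▸ hlt) ⟨w, hw⟩ rfl)

lemma SimpleGraph.Connected.exists_adj_dist_add_one_eq {V : Type*} {G : SimpleGraph V} (hG : G.Connected)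
    {u s : V} (hus : u ≠ s) : ∃ w, G.Adj u w ∧ G.dist w s + 1 = G.dist u s := by
  obtain ⟨p, hp⟩ := hG.exists_walk_length_eq_dist u s
  cases p with
  | nil => exact absurd rfl hus
  | @cons _ w _ h q =>
    refine ⟨w, h, ?_⟩
    have h₁ := dist_le q
    have h₂ := hG.dist_triangle (u := u) (v := w) (w := s)
    rw [dist_eq_one_iff_adj.2 h] at h₂
    rw [Walk.length_cons] at hp
    omega

/-- A geodesic of an induced subgraph, together with a vertex adjacent to exactly its two ends,
is an induced cycle. -/
lemma SimpleGraph.nonempty_cycleGraph_embedding {V : Type*} {G : SimpleGraph V} {S : Set V} {a b : S}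
    {p : (G.induce S).Walk a b} (hp : p.length = (G.induce S).dist a b) {v : V} (hv : v ∉ S)
    (hva : G.Adj v a) (hvb : G.Adj v b) (h : ∀ u : S, G.Adj v u → u = a ∨ u = b) :
    Nonempty (cycleGraph (p.length + 2) ↪g G) := by
  let f : Fin (p.length + 2) → V := fun i => if i.val ≤ p.length then p.getVert i else v
  have f_path {i : Fin (p.length + 2)} (hi : i.val ≤ p.length) : f i = p.getVert i := if_pos hi
  have f_last {i : Fin (p.length + 2)} (hi : ¬ i.val ≤ p.length) : f i = v := if_neg hi
  have f_inj : f.Injective := by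
    intro i j hij
    have hi := i.isLt
    have hj := j.isLt
    by_cases h₁ : i.val ≤ p.length <;> by_cases h₂ : j.val ≤ p.length
    · rw [f_path h₁, f_path h₂] at hij
      exact Fin.ext (Walk.getVert_inj_of_length_eq_dist hp h₁ h₂ (Subtype.ext hij))
    · rw [f_path h₁, f_last h₂] at hij
      exact absurd (hij ▸ (p.getVert i).2) hv
    · rw [f_last h₁, f_path h₂] at hij
      exact absurd (hij ▸ (p.getVert j).2) hv
    · exact Fin.ext (by omega)
  have f_adj {i j : Fin (p.length + 2)} (hij : i ≤ j) :
      G.Adj (f i) (f j) ↔ (cycleGraph (p.length + 2)).Adj i j := by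
    rw [cycleGraph_adj_iff_of_le hij]
    have hle : i.val ≤ j.val := hij
    have hj := j.isLt
    by_cases h₂ : j.val ≤ p.length
    · rw [f_path (hle.trans h₂), f_path h₂, ← induce_adj,
        Walk.adj_getVert_iff_of_length_eq_dist hp hle h₂]
      omega
    · rw [f_last h₂]
      by_cases h₁ : i.val ≤ p.length
      · rw [f_path h₁, G.adj_comm]
        constructor
        · intro hadj
          rcases h _ hadj with e | e
          · have := Walk.getVert_inj_of_length_eq_dist hp h₁ (Nat.zero_le _)
              (e.trans p.getVert_zero.symm)
            omega
          · have := Walk.getVert_inj_of_length_eq_dist hp h₁ le_rfl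
              (e.trans p.getVert_length.symm)
            omega
        · rintro (e | e)
          · rw [show i.val = p.length by omega, p.getVert_length]
            exact hvb
          · rw [e.1, p.getVert_zero]
            exact hva
      · rw [f_last h₁]
        simp only [SimpleGraph.irrefl, false_iff]
        omega
  refine ⟨⟨⟨f, f_inj⟩, fun {i j} => ?_⟩⟩
  rcases le_total i j with hij | hij
  · exact f_adj hij
  · rw [G.adj_comm, SimpleGraph.adj_comm _ i]
    exact f_adj hij

/-- In a finite connected chordal graph, if `x ≠ y` are at distance `k` from `s`
and have a common neighbor `v` at distance `k+1` from `s`, then `x` and `y` are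
adjacent. -/
theorem chordal_common_neighbor_adjacent
    {V : Type} [Fintype V] {G : SimpleGraph V}
    (hconn : G.Connected) (hch : Chordal G)
    (s x y v : V) (k : ℕ) (hxy : x ≠ y)
    (hx : G.dist x s = k) (hy : G.dist y s = k)
    (hvx : G.Adj v x) (hvy : G.Adj v y)
    (hv : G.dist v s = k + 1) :
    G.Adj x y := by
  by_contra hnadj
  let S : Set V := {u | u = x ∨ u = y ∨ G.dist u s < k}
  have dist_le_of_mem {u : V} (hu : u ∈ S) : G.dist u s ≤ k := by
    rcases hu with rfl | rfl | hu <;> omega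
  have hk : 0 < k := by
    rw [Nat.pos_iff_ne_zero]
    rintro rfl
    exact hxy ((hconn.dist_eq_zero_iff.1 hx).trans (hconn.dist_eq_zero_iff.1 hy).symm)
  have hsS : s ∈ S := Or.inr (Or.inr (by rwa [dist_self]))
  have hreach := induce_reachable_of_exists_closer (G := G) (S := S) ⟨s, hsS⟩ (by
    intro u hu (hus : u ≠ s)
    obtain ⟨w, huw, hw⟩ := hconn.exists_adj_dist_add_one_eq hus
    have := dist_le_of_mem hu
    exact ⟨w, Or.inr (Or.inr (by omega)), huw, by dsimp only; omega⟩)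
  let a : S := ⟨x, Or.inl rfl⟩
  let b : S := ⟨y, Or.inr (Or.inl rfl)⟩
  have hab : (G.induce S).Reachable a b := (hreach a).trans (hreach b).symm
  obtain ⟨p, hp⟩ := hab.exists_walk_length_eq_dist
  have hvS : v ∉ S := fun h => by
    have := dist_le_of_mem h
    omega
  have hlen : 2 ≤ p.length := by
    have h₀ : (G.induce S).dist a b ≠ 0 := fun h =>
      hxy (congrArg Subtype.val (hab.dist_eq_zero_iff.1 h))
    have h₁ : (G.induce S).dist a b ≠ 1 := fun h =>
      hnadj (induce_adj.1 (dist_eq_one_iff_adj.1 h))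
    omega
  obtain ⟨e⟩ := nonempty_cycleGraph_embedding hp hvS hvx hvy (by
    rintro ⟨u, rfl | rfl | hu⟩ hvu
    · exact Or.inl rfl
    · exact Or.inr rfl
    · have h := hconn.dist_triangle (u := v) (v := u) (w := s)
      rw [dist_eq_one_iff_adj.2 hvu] at h
      omega)
  exact (hch.isEmpty_embedding (by omega)).false e
end

section
/- Let G be a finite connected chordal graph and let P : V(G) → ℕ satisfy: (i) every vertex v with P(v) = 0 has P(u) = 1 for every neighbor u of v; (ii) every vertex v with P(v) > 0 has some neighbor u with P(u) = P(v) − 1, and every neighbor u of v satisfies |P(u) − P(v)| ≤ 1; (iii) for every vertex v with P(v) > 0, any two distinct neighbors u₁, u₂ of v with P(u₁) = P(u₂) = P(v) − 1 are adjacent; (iv) for every vertex v with P(v) > 0 and all neighbors u, y of v with P(u) = P(v) − 1 and P(y) = P(v): if u is not adjacent to y, then every neighbor z of y with P(z) = P(v) − 1 is adjacent to v. Then there is exactly one vertex s with P(s) = 0, and P(v) = d(v,s) for every vertex v. -/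
open SimpleGraph

/-- Iterating a level-decreasing choice of neighbor ends at the same vertex for any two
adjacent vertices of the same level, provided lower neighbors of a vertex are pairwise adjacent
and adjacent vertices of the same positive level have a common lower neighbor. -/
theorem iterate_lower_eq_of_adj_of_level_eq {V : Type*} {G : SimpleGraph V} {P : V → ℕ}
    {c : V → V} (hc : ∀ v, 0 < P v → G.Adj v (c v) ∧ P (c v) + 1 = P v)
    (hzero : ∀ v, P v = 0 → ∀ u, G.Adj v u → P u ≠ 0)
    (hclique : ∀ v u₁ u₂, G.Adj v u₁ → G.Adj v u₂ → u₁ ≠ u₂ →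
      P u₁ + 1 = P v → P u₂ + 1 = P v → G.Adj u₁ u₂)
    (hcommon : ∀ v y, 0 < P v → G.Adj v y → P y = P v →
      ∃ w, G.Adj v w ∧ G.Adj y w ∧ P w + 1 = P v)
    (n : ℕ) : ∀ v y, P v = n → P y = n → G.Adj v y → c^[n] v = c^[n] y := by
  induction n with
  | zero => exact fun v y hv hy h => absurd hy (hzero v hv y h)
  | succ k ih =>
    have lower : ∀ v u, P v = k + 1 → G.Adj v u → P u = k → c^[k + 1] v = c^[k] u := by
      intro v u hv hvu hu
      obtain ⟨hadj, hlev⟩ := hc v (by omega)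
      rw [Function.iterate_succ_apply]
      by_cases h : c v = u
      · rw [h]
      · exact ih _ _ (by omega) hu
          (hclique v _ _ hadj hvu h hlev (by omega))
    intro v y hv hy h
    obtain ⟨w, hvw, hyw, hw⟩ := hcommon v y (by omega) h (by omega)
    rw [lower v w hv hvw (by omega), lower y w hy hyw (by omega)]

/-- Iterating a level-decreasing choice of neighbor as many times as the level indicates reaches
level zero along a walk of that length. -/
theorem exists_walk_iterate_lower {V : Type*} {G : SimpleGraph V} {P : V → ℕ}
    {c : V → V} (hc : ∀ v, 0 < P v → G.Adj v (c v) ∧ P (c v) + 1 = P v)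
    (n : ℕ) : ∀ v, P v = n → P (c^[n] v) = 0 ∧ ∃ p : G.Walk v (c^[n] v), p.length = n := by
  induction n with
  | zero => exact fun v hv => ⟨hv, Walk.nil, rfl⟩
  | succ k ih =>
    intro v hv
    obtain ⟨hadj, hlev⟩ := hc v (by omega)
    obtain ⟨h0, p, hp⟩ := ih (c v) (by omega)
    exact ⟨h0, Walk.cons hadj p, by simp [hp]⟩

/-- A function growing by at most one along edges grows by at most the length of a walk. -/
theorem le_add_walk_length {V : Type*} {G : SimpleGraph V} {P : V → ℕ}
    (hP : ∀ v u, G.Adj v u → P v ≤ P u + 1) {v w : V} (p : G.Walk v w) :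
    P v ≤ P w + p.length := by
  induction p with
  | nil => simp
  | cons h p ih =>
    have := hP _ _ h
    rw [Walk.length_cons]
    omega

/-- Soundness of the distance certificates in chordal graphs: in a finite
connected chordal graph, if `P : V → ℕ` satisfies the local rules (i)–(iv),
then there is exactly one vertex `s` with `P s = 0`, and `P v = d(v, s)` for
every vertex `v`. -/
theorem chordal_local_rules_imply_distance
    {V : Type} [Fintype V] {G : SimpleGraph V}
    (hconn : G.Connected) (hch : Chordal G) (P : V → ℕ)
    -- (i) every vertex with value 0 has all its neighbors of value 1
    (h1 : ∀ v : V, P v = 0 → ∀ u : V, G.Adj v u → P u = 1)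
    -- (ii) every vertex with positive value has a neighbor of value one less,
    -- and values of neighbors differ by at most 1
    (h2 : ∀ v : V, 0 < P v → ∃ u : V, G.Adj v u ∧ P u + 1 = P v)
    (h2' : ∀ v : V, 0 < P v → ∀ u : V, G.Adj v u → |(P u : ℤ) - (P v : ℤ)| ≤ 1)
    -- (iii) two distinct neighbors of `v` with value `P v − 1` are adjacent
    (h3 : ∀ v : V, 0 < P v → ∀ u₁ u₂ : V, G.Adj v u₁ → G.Adj v u₂ → u₁ ≠ u₂ →
      P u₁ + 1 = P v → P u₂ + 1 = P v → G.Adj u₁ u₂)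
    -- (iv) for neighbors `u`, `y` of `v` with `P u = P v − 1` and `P y = P v`:
    -- if `u` is not adjacent to `y`, then every neighbor `z` of `y` with
    -- `P z = P v − 1` is adjacent to `v`
    (h4 : ∀ v : V, 0 < P v → ∀ u y : V, G.Adj v u → G.Adj v y →
      P u + 1 = P v → P y = P v → ¬ G.Adj u y →
      ∀ z : V, G.Adj y z → P z + 1 = P v → G.Adj z v) :
    ∃ s : V, P s = 0 ∧ (∀ t : V, P t = 0 → t = s) ∧ ∀ v : V, P v = G.dist v s := by
  have lipschitz : ∀ v u, G.Adj v u → P v ≤ P u + 1 := by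
    intro v u h
    rcases Nat.eq_zero_or_pos (P v) with hv | hv
    · omega
    · have := abs_le.mp (h2' v hv u h)
      omega
  have lower_exists : ∀ v, ∃ u, 0 < P v → G.Adj v u ∧ P u + 1 = P v := by
    intro v
    by_cases hv : 0 < P v
    · obtain ⟨u, hu⟩ := h2 v hv
      exact ⟨u, fun _ => hu⟩
    · exact ⟨v, fun h => absurd h hv⟩
  choose c hc using lower_exists
  have hzero : ∀ v, P v = 0 → ∀ u, G.Adj v u → P u ≠ 0 := by
    intro v hv u h
    have := h1 v hv u h
    omega
  have hclique : ∀ v u₁ u₂, G.Adj v u₁ → G.Adj v u₂ → u₁ ≠ u₂ →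
      P u₁ + 1 = P v → P u₂ + 1 = P v → G.Adj u₁ u₂ :=
    fun v u₁ u₂ hu₁ hu₂ hne hp₁ hp₂ => h3 v (by omega) u₁ u₂ hu₁ hu₂ hne hp₁ hp₂
  have hcommon : ∀ v y, 0 < P v → G.Adj v y → P y = P v →
      ∃ w, G.Adj v w ∧ G.Adj y w ∧ P w + 1 = P v := by
    intro v y hv hvy hy
    obtain ⟨hvu, hu⟩ := hc v hv
    obtain ⟨hyz, hz⟩ := hc y (by omega)
    by_cases h : G.Adj (c v) y
    · exact ⟨c v, hvu, h.symm, hu⟩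
    · exact ⟨c y, (h4 v hv _ y hvu hvy hu hy h _ hyz (by omega)).symm, hyz, by omega⟩
  have same := iterate_lower_eq_of_adj_of_level_eq hc hzero hclique hcommon
  have lower : ∀ v u, G.Adj v u → P u + 1 = P v → c^[P v] v = c^[P u] u := by
    intro v u hvu hu
    obtain ⟨hadj, hlev⟩ := hc v (by omega)
    rw [← hu, Function.iterate_succ_apply]
    by_cases h : c v = u
    · rw [h]
    · exact same _ _ _ (by omega) rfl (hclique v _ _ hadj hvu h hlev hu)
  have edge : ∀ v u, G.Adj v u → c^[P v] v = c^[P u] u := by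
    intro v u h
    have h₁ := lipschitz v u h
    have h₂ := lipschitz u v h.symm
    rcases lt_trichotomy (P v) (P u) with hlt | heq | hgt
    · exact (lower u v h.symm (by omega)).symm
    · rw [heq]
      exact same _ _ _ heq rfl h
    · exact lower v u h (by omega)
  have const : ∀ v u, c^[P v] v = c^[P u] u := by
    intro v u
    obtain ⟨p⟩ := hconn.preconnected v u
    induction p with
    | nil => rfl
    | cons h _ ih => exact (edge _ _ h).trans ih
  obtain ⟨v₀⟩ := hconn.nonempty
  have root_zero := (exists_walk_iterate_lower hc _ v₀ rfl).1
  refine ⟨c^[P v₀] v₀, root_zero, fun t ht => ?_, fun v => le_antisymm ?_ ?_⟩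
  · rw [const v₀ t, ht, Function.iterate_zero_apply]
  · obtain ⟨p, hp⟩ := hconn.exists_walk_length_eq_dist v (c^[P v₀] v₀)
    have := le_add_walk_length lipschitz p
    omega
  · rw [const v₀ v]
    obtain ⟨-, p, hp⟩ := exists_walk_iterate_lower hc _ v rfl
    exact (dist_le p).trans_eq hp
end

section
/- Let G be a finite connected chordal graph, let s be any vertex of G, and define P(v) = d(v,s) for every vertex v. Then P satisfies: (i) every vertex v with P(v) = 0 has P(u) = 1 for every neighbor u of v; (ii) every vertex v with P(v) > 0 has some neighbor u with P(u) = P(v) − 1, and every neighbor u of v satisfies |P(u) − P(v)| ≤ 1; (iii) for every vertex v with P(v) > 0, any two distinct neighbors u₁, u₂ of v with P(u₁) = P(u₂) = P(v) − 1 are adjacent; (iv) for every vertex v with P(v) > 0 and all neighbors u, y of v with P(u) = P(v) − 1 and P(y) = P(v): if u is not adjacent to y, then every neighbor z of y with P(z) = P(v) − 1 is adjacent to v. -/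
open SimpleGraph

theorem Fin.val_sub_eq_one_iff {n : ℕ} (i j : Fin (n + 2)) :
    (i - j).val = 1 ↔ i.val = j.val + 1 ∨ (i.val = 0 ∧ j.val = n + 1) := by
  rcases le_or_gt j i with h | h
  · rw [Fin.sub_val_of_le h]
    have := Fin.le_def.mp h
    omega
  · rw [Fin.coe_sub_iff_lt.mpr h]
    have := Fin.lt_def.mp h
    omega

/-- A chord between two vertices of a shortest walk does not skip vertices. -/
theorem SimpleGraph.Walk.le_succ_of_adj_getVert {V : Type*} {G : SimpleGraph V} {a b : V}
    (p : G.Walk a b) (hp : p.length = G.dist a b) {i j : ℕ} (hj : j ≤ p.length)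
    (h : G.Adj (p.getVert i) (p.getVert j)) : j ≤ i + 1 := by
  have hle := dist_le ((p.take i).append (.cons h (p.drop j)))
  simp only [Walk.length_append, Walk.length_cons, Walk.take_length, Walk.drop_length] at hle
  omega

/-- If two neighbors of `v` are joined by a walk whose remaining vertices avoid `v` and its
neighbors, then in a chordal graph they are equal or adjacent. -/
theorem Chordal.eq_or_adj_of_walk {V : Type} {G : SimpleGraph V} (hch : Chordal G) {v a b : V}
    (ha : G.Adj v a) (hb : G.Adj v b) (p : G.Walk a b)
    (hp : ∀ w ∈ p.support, w = a ∨ w = b ∨ (w ≠ v ∧ ¬ G.Adj v w)) : a = b ∨ G.Adj a b := by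
  by_contra! hab
  obtain ⟨hne, hnadj⟩ := hab
  let W : Set V := {w | w = a ∨ w = b ∨ (w ≠ v ∧ ¬ G.Adj v w)}
  obtain ⟨q, hq⟩ := (p.induce W hp).reachable.exists_walk_length_eq_dist
  have hpath := q.isPath_of_length_eq_dist hq
  set n := q.length with hn
  let x : ℕ → V := fun i => (q.getVert i).val
  have hx0 : x 0 = a := by simp [x]
  have hxn : x n = b := by simp [x, hn]
  have hinj : ∀ i j, i ≤ n → j ≤ n → x i = x j → i = j := fun i j hi hj h =>
    hpath.getVert_injOn hi hj (Subtype.ext h)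
  have hxv : ∀ i, x i ≠ v := by
    intro i
    rcases (q.getVert i).2 with h | h | h
    · exact fun h' => ha.ne (h'.symm.trans h)
    · exact fun h' => hb.ne (h'.symm.trans h)
    · exact h.1
  have hadj : ∀ i j, i ≤ n → j ≤ n → (G.Adj (x i) (x j) ↔ i = j + 1 ∨ j = i + 1) := by
    intro i j hi hj
    constructor
    · intro h
      have hij : i ≠ j := by
        rintro rfl
        exact h.ne rfl
      have h₁ := q.le_succ_of_adj_getVert hq (i := i) hj h
      have h₂ := q.le_succ_of_adj_getVert hq (i := j) hi h.symm
      omega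
    · rintro (rfl | rfl)
      · exact (q.adj_getVert_succ (i := j) (by omega)).symm
      · exact q.adj_getVert_succ (i := i) (by omega)
  have hvadj : ∀ i, i ≤ n → (G.Adj v (x i) ↔ i = 0 ∨ i = n) := by
    intro i hi
    constructor
    · intro h
      rcases (q.getVert i).2 with h' | h' | h'
      · exact .inl (hinj i 0 hi (by omega) (h'.trans hx0.symm))
      · exact .inr (hinj i n hi le_rfl (h'.trans hxn.symm))
      · exact absurd h h'.2
    · rintro (rfl | rfl)
      · rwa [hx0]
      · rwa [hxn]
  have hn2 : 2 ≤ n := by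
    by_contra! hlt
    have h01 : n = 0 ∨ n = 1 := by omega
    rcases h01 with h | h
    · exact hne (by rw [← hx0, ← hxn, h])
    · apply hnadj
      rw [← hx0, ← hxn, hadj 0 n (by omega) le_rfl]
      omega
  let f : Fin (n + 2) → V := fun i => if i.val ≤ n then x i.val else v
  have hf : Function.Injective f := by
    intro i j hij
    have hi := i.2
    have hj := j.2
    apply Fin.ext
    dsimp only [f] at hij
    split_ifs at hij with h₁ h₂ h₂
    · exact hinj _ _ h₁ h₂ hij
    · exact absurd hij (hxv _)
    · exact absurd hij.symm (hxv _)
    · omega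
  let e : cycleGraph (n + 2) ↪g G :=
    { toFun := f
      inj' := hf
      map_rel_iff' := by
        intro i j
        have hi := i.2
        have hj := j.2
        change G.Adj (f i) (f j) ↔ _
        rw [cycleGraph_adj', Fin.val_sub_eq_one_iff, Fin.val_sub_eq_one_iff]
        dsimp only [f]
        split_ifs with h₁ h₂ h₂
        · rw [hadj _ _ h₁ h₂]
          omega
        · rw [G.adj_comm, hvadj _ h₁]
          omega
        · rw [hvadj _ h₂]
          omega
        · simp only [SimpleGraph.irrefl, false_iff]
          omega }
  exact (hch (Set.range e) (n + 2) (by omega)).false e.isoInduceRange.symm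

/-- A geodesic to `s` strictly decreases the distance to `s` after its first vertex. -/
theorem SimpleGraph.Connected.exists_walk_dist_lt {V : Type*} {G : SimpleGraph V}
    (hconn : G.Connected) (x s : V) :
    ∃ p : G.Walk x s, ∀ w ∈ p.support, w = x ∨ G.dist w s < G.dist x s := by
  obtain ⟨p, hp⟩ := hconn.exists_walk_length_eq_dist x s
  refine ⟨p, fun w hw => ?_⟩
  obtain ⟨i, rfl, hi⟩ := Walk.mem_support_iff_exists_getVert.mp hw
  rcases Nat.eq_zero_or_pos i with rfl | hpos
  · simp
  · have hle := dist_le (p.drop i)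
    rw [Walk.drop_length] at hle
    right
    omega

/-- Any two vertices are joined by a walk whose other vertices are closer to `s` than one of
the endpoints. -/
theorem SimpleGraph.Connected.exists_walk_through {V : Type*} {G : SimpleGraph V}
    (hconn : G.Connected) (a b s : V) :
    ∃ p : G.Walk a b, ∀ w ∈ p.support,
      w = a ∨ w = b ∨ G.dist w s < max (G.dist a s) (G.dist b s) := by
  obtain ⟨p, hp⟩ := hconn.exists_walk_dist_lt a s
  obtain ⟨q, hq⟩ := hconn.exists_walk_dist_lt b s
  refine ⟨p.append q.reverse, fun w hw => ?_⟩
  rw [Walk.mem_support_append_iff, Walk.support_reverse, List.mem_reverse] at hw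
  rcases hw with hw | hw
  · rcases hp w hw with h | h
    · exact .inl h
    · exact .inr (.inr (lt_max_of_lt_left h))
  · rcases hq w hw with h | h
    · exact .inr (.inl h)
    · exact .inr (.inr (lt_max_of_lt_right h))

/-- Completeness of the distance certificates in chordal graphs: in a finite
connected chordal graph, the function `P v = d(v, s)` satisfies the local rules
(i)–(iv). -/
theorem chordal_distance_satisfies_local_rules
    {V : Type} [Fintype V] {G : SimpleGraph V}
    (hconn : G.Connected) (hch : Chordal G) (s : V)
    (P : V → ℕ) (hP : ∀ v : V, P v = G.dist v s) :
    -- (i) every vertex with value 0 has all its neighbors of value 1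
    (∀ v : V, P v = 0 → ∀ u : V, G.Adj v u → P u = 1) ∧
    -- (ii) every vertex with positive value has a neighbor of value one less,
    -- and values of neighbors differ by at most 1
    (∀ v : V, 0 < P v → ∃ u : V, G.Adj v u ∧ P u + 1 = P v) ∧
    (∀ v : V, 0 < P v → ∀ u : V, G.Adj v u → |(P u : ℤ) - (P v : ℤ)| ≤ 1) ∧
    -- (iii) two distinct neighbors of `v` with value `P v − 1` are adjacent
    (∀ v : V, 0 < P v → ∀ u₁ u₂ : V, G.Adj v u₁ → G.Adj v u₂ → u₁ ≠ u₂ →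
      P u₁ + 1 = P v → P u₂ + 1 = P v → G.Adj u₁ u₂) ∧
    -- (iv) for neighbors `u`, `y` of `v` with `P u = P v − 1` and `P y = P v`:
    -- if `u` is not adjacent to `y`, then every neighbor `z` of `y` with
    -- `P z = P v − 1` is adjacent to `v`
    (∀ v : V, 0 < P v → ∀ u y : V, G.Adj v u → G.Adj v y →
      P u + 1 = P v → P y = P v → ¬ G.Adj u y →
      ∀ z : V, G.Adj y z → P z + 1 = P v → G.Adj z v) := by
  obtain rfl : P = fun v => G.dist v s := funext hP
  dsimp only
  have hstep : ∀ {v u : V}, G.Adj v u → G.dist v s ≤ G.dist u s + 1 := by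
    intro v u h
    have htri := hconn.dist_triangle (u := v) (v := u) (w := s)
    rw [dist_eq_one_iff_adj.mpr h] at htri
    omega
  have hfar : ∀ {v w : V}, G.dist w s + 1 < G.dist v s → w ≠ v ∧ ¬ G.Adj v w := by
    intro v w h
    refine ⟨?_, fun hadj => ?_⟩
    · rintro rfl
      omega
    · have := hstep hadj
      omega
  refine ⟨?_, ?_, ?_, ?_, ?_⟩
  · intro v hv u hvu
    obtain rfl := hconn.dist_eq_zero_iff.mp hv
    exact dist_eq_one_iff_adj.mpr hvu.symm
  · intro v hv
    obtain ⟨p, hp⟩ := hconn.exists_walk_length_eq_dist v s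
    cases p with
    | nil => simp at hv
    | @cons _ u _ h q =>
      refine ⟨u, h, ?_⟩
      have h₁ := dist_le q
      have h₂ := hstep h
      rw [Walk.length_cons] at hp
      omega
  · intro v _ u hvu
    have h₁ := hstep hvu
    have h₂ := hstep hvu.symm
    rw [abs_le]
    omega
  · intro v _ u₁ u₂ h₁ h₂ hne hd₁ hd₂
    obtain ⟨p, hp⟩ := hconn.exists_walk_through u₁ u₂ s
    refine (hch.eq_or_adj_of_walk h₁ h₂ p fun w hw => ?_).resolve_left hne
    refine (hp w hw).imp_right (Or.imp_right fun h => hfar ?_)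
    omega
  · intro v _ u y hu hy hdu hdy huy z hyz hdz
    by_contra hzv
    obtain ⟨p, hp⟩ := hconn.exists_walk_through u z s
    have key := hch.eq_or_adj_of_walk hu hy (p.concat hyz.symm) fun w hw => by
      rw [Walk.support_concat, List.mem_append, List.mem_singleton] at hw
      rcases hw with hw | rfl
      · rcases hp w hw with h | rfl | h
        · exact .inl h
        · refine .inr (.inr ⟨?_, fun h => hzv h.symm⟩)
          rintro rfl
          omega
        · exact .inr (.inr (hfar (by omega)))
      · exact .inr (.inl rfl)
    rcases key with rfl | h
    · omega
    · exact huy h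
end

section
/- Let G be a finite connected simple graph, let id : V(G) → ℕ be injective, let sel : V(G) → {0,1}, and suppose each vertex v is assigned a triple (a_v, d_v, s_v) ∈ ℕ³ with s_v ∈ {0,1} such that for every vertex v: (1) a_u = a_v for every neighbor u of v; (2) if d_v = 0 then id(v) = a_v; (3) if id(v) = a_v then d_v = 0; (4) if d_v > 0 then exactly one neighbor u of v has d_u = d_v − 1, and every other neighbor w of v satisfies d_w ∈ {d_v, d_v + 1}; (5) s_v = sel(v) + Σ_{w ∈ N(v), d_w ≥ d_v} s_w. Then at most one vertex v has sel(v) = 1. -/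
open SimpleGraph

/-- Soundness of the spanning-tree counting certificates: let `G` be a finite
connected graph with injective identifiers `id` and selection bits
`sel : V → {0,1}`, and suppose each vertex `v` carries a triple
`(a v, d v, t v) ∈ ℕ³` with `t v ∈ {0,1}` such that:
(1) `a` is constant on neighborhoods; (2) if `d v = 0` then `id v = a v`;
(3) if `id v = a v` then `d v = 0`; (4) if `d v > 0` then exactly one neighbor
`u` of `v` has `d u = d v − 1`, and every neighbor `w` of `v` has
`d w ∈ {d v − 1, d v, d v + 1}`; (5) `t v` equals `sel v` plus the sum of `t w`
over all neighbors `w` of `v` with `d w ≥ d v`.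
Then at most one vertex is selected. -/
theorem spanning_tree_counting_sound
    {V : Type} [Fintype V] [DecidableEq V]
    (G : SimpleGraph V) [DecidableRel G.Adj] (hconn : G.Connected)
    (id : V → ℕ) (hid : Function.Injective id)
    (sel : V → ℕ) (hsel : ∀ v, sel v ≤ 1)
    (a d t : V → ℕ) (ht : ∀ v, t v ≤ 1)
    (h1 : ∀ v u, G.Adj v u → a u = a v)
    (h2 : ∀ v, d v = 0 → id v = a v)
    (h3 : ∀ v, id v = a v → d v = 0)
    (h4 : ∀ v, 0 < d v →
      (∃! u, G.Adj v u ∧ d u + 1 = d v) ∧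
      (∀ w, G.Adj v w → d w + 1 = d v ∨ d w = d v ∨ d w = d v + 1))
    (h5 : ∀ v, t v = sel v +
      ∑ w ∈ Finset.univ.filter (fun w => G.Adj v w ∧ d v ≤ d w), t w) :
    ∀ u v, sel u = 1 → sel v = 1 → u = v := by
  have ha : ∀ u v, a u = a v := fun u v ↦ by
    obtain ⟨p⟩ := hconn.preconnected u v
    induction p with
    | nil => rfl
    | cons h _ ih => exact (h1 _ _ h).symm.trans ih
  have hchild : ∀ p x, G.Adj p x → d p ≤ d x → sel p + t x ≤ t p := fun p x hadj hd ↦ by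
    rw [h5 p]
    gcongr
    exact Finset.single_le_sum (f := t) (fun _ _ ↦ Nat.zero_le _) (by simp [hadj, hd])
  have hchildren : ∀ p x y, G.Adj p x → d p ≤ d x → G.Adj p y → d p ≤ d y → x ≠ y →
      t x + t y ≤ t p := fun p x y hx hdx hy hdy hne ↦ by
    rw [h5 p, ← Finset.sum_pair hne]
    refine le_add_left (Finset.sum_le_sum_of_subset ?_)
    simp [Finset.insert_subset_iff, *]
  have hparent : ∀ x, t x = 1 → 0 < d x → ∃ p, G.Adj p x ∧ d p + 1 = d x ∧ t p = 1 :=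
    fun x hx hd ↦ by
    obtain ⟨p, ⟨hadj, hp⟩, -⟩ := (h4 x hd).1
    have := hchild p x hadj.symm (by omega)
    have := ht p
    exact ⟨p, hadj.symm, hp, by omega⟩
  have hlevel : ∀ n x y, d x = n → d y = n → t x = 1 → t y = 1 → x = y := fun n ↦ by
    induction n with
    | zero =>
      intro x y hx hy _ _
      exact hid ((h2 x hx).trans ((ha x y).trans (h2 y hy).symm))
    | succ n ih =>
      intro x y hx hy htx hty
      obtain ⟨p, hpx, hdp, htp⟩ := hparent x htx (by omega)
      obtain ⟨q, hqy, hdq, htq⟩ := hparent y hty (by omega)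
      obtain rfl := ih p q (by omega) (by omega) htp htq
      by_contra hne
      have := hchildren p x y hpx (by omega) hqy (by omega) hne
      omega
  have hancestor : ∀ k n x, d x = n + k → t x = 1 → ∃ y, d y = n ∧ t y = 1 := fun k ↦ by
    induction k with
    | zero => exact fun n x hd hx ↦ ⟨x, hd, hx⟩
    | succ k ih =>
      intro n x hd hx
      obtain ⟨p, -, hp, htp⟩ := hparent x hx (by omega)
      exact ih n p (by omega) htp
  have hselected : ∀ v, sel v = 1 → t v = 1 := fun v hv ↦ by
    have := h5 v
    have := ht v
    omega
  have hdepth : ∀ u v, sel u = 1 → sel v = 1 → d v ≤ d u := fun u v hu hv ↦ by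
    by_contra! hlt
    obtain ⟨y, hdy, hty⟩ := hancestor (d v - (d u + 1)) (d u + 1) v (by omega) (hselected v hv)
    obtain ⟨p, hadj, hdp, htp⟩ := hparent y hty (by omega)
    obtain rfl := hlevel (d u) p u (by omega) rfl htp (hselected u hu)
    have := hchild p y hadj (by omega)
    omega
  intro u v hu hv
  exact hlevel (d v) u v (le_antisymm (hdepth v u hv hu) (hdepth u v hu hv)) rfl
    (hselected u hu) (hselected v hv)
end
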